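/- arXiv:2311.00695 — 3 statements merged into one kernel-verified Lean document; each statement's English description precedes it below -/
import Mathlib

section
/- (Proposition 1, discrete phases form a diagonal unitary k-design.) Let k ≥ 1, d ≥ 1, and let k' be an integer with 1 ≤ k' ≤ k. For a function φ : Fin d → Fin (k+1), let θ_φ : Fin d → ℝ be given by (θ_φ)_j = 2π·φ_j/(k+1). Then for every complex matrix M indexed by (Fin k' → Fin d), the finite average (k+1)^{-d} Σ_{φ : Fin d → Fin (k+1)} Λ(θ_φ)^{⊗k'} · M · (Λ(θ_φ)†)^{⊗k'} equals the continuous expectation E_θ[ Λ(θ)^{⊗k'} · M · (Λ(θ)†)^{⊗k'} ], where Λ(θ)^{⊗k'} denotes the k'-fold Kronecker power, i.e. the diagonal matrix on index set (Fin k' → Fin d) with entry exp(i Σ_{m} θ_{x_m}) at x. -/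
open MeasureTheory Matrix Complex
open scoped ComplexOrder

attribute [local instance] Matrix.normedAddCommGroup Matrix.normedSpace

/-- The uniform probability measure on `[0, 2π)`. -/
noncomputable def uniformPhase : Measure ℝ :=
  (ENNReal.ofReal (2 * Real.pi))⁻¹ • (volume.restrict (Set.Ico 0 (2 * Real.pi)))

instance : IsProbabilityMeasure uniformPhase := by
  constructor
  rw [uniformPhase, Measure.smul_apply, Measure.restrict_apply_univ, Real.volume_Ico]
  simp only [sub_zero, smul_eq_mul]
  exact ENNReal.inv_mul_cancel (by simp [Real.pi_pos, Real.pi_ne_zero, ne_of_gt,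
    mul_pos, Real.pi_pos]) ENNReal.ofReal_ne_top

/-- Product of uniform phase measures over the coordinates of `ι`. -/
noncomputable def phaseMeasure (ι : Type*) [Fintype ι] : Measure (ι → ℝ) :=
  Measure.pi fun _ => uniformPhase

/-- The random diagonal unitary `Λ(θ)` with diagonal entries `exp (i θ_j)`. -/
noncomputable def Lam {ι : Type*} [DecidableEq ι] (θ : ι → ℝ) : Matrix ι ι ℂ :=
  Matrix.diagonal fun j => Complex.exp (Complex.I * θ j)

/-- The `k'`-fold Kronecker power of `Λ(θ)`: the diagonal matrix on index set
`Fin k' → Fin d` with entry `exp (i Σ_m θ_{x m})` at `x`. -/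
noncomputable def LamPow {d : ℕ} (k' : ℕ) (θ : Fin d → ℝ) :
    Matrix (Fin k' → Fin d) (Fin k' → Fin d) ℂ :=
  Matrix.diagonal fun x => Complex.exp (Complex.I * ∑ m, θ (x m))

/-- The character `θ ↦ exp (i n θ)` has mean `1` if `n = 0` and `0` otherwise. -/
theorem integral_exp_uniformPhase (n : ℤ) :
    ∫ t, Complex.exp (Complex.I * n * (t : ℝ)) ∂uniformPhase = if n = 0 then 1 else 0 := by
  split_ifs with h
  · simp [h]
  · rw [uniformPhase, integral_smul_measure, integral_Ico_eq_integral_Ioc,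
      ← intervalIntegral.integral_of_le Real.two_pi_pos.le,
      integral_exp_mul_complex (mul_ne_zero Complex.I_ne_zero (Int.cast_ne_zero.2 h))]
    have h1 : Complex.exp (Complex.I * n * ((2 * Real.pi : ℝ) : ℂ)) = 1 :=
      Complex.exp_eq_one_iff.2 ⟨n, by push_cast; ring⟩
    rw [h1]
    simp

/-- The average of a character of frequency `|n| ≤ k` over `k + 1` equally spaced phases. -/
theorem average_exp_discrete_phases (k : ℕ) (n : ℤ) (hn : |n| ≤ k) :
    ((k : ℂ) + 1)⁻¹ * ∑ t : Fin (k + 1),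
      Complex.exp (Complex.I * n * ((2 * Real.pi * (t : ℝ) / (k + 1) : ℝ) : ℂ))
      = if n = 0 then 1 else 0 := by
  have hk : (k : ℂ) + 1 ≠ 0 := Nat.cast_add_one_ne_zero k
  split_ifs with h
  · simp [h, hk]
  · set z : ℂ := Complex.exp (Complex.I * n * (2 * Real.pi / (k + 1))) with hz
    have hpow (t : ℕ) : Complex.exp (Complex.I * n * ((2 * Real.pi * (t : ℝ) / (k + 1) : ℝ) : ℂ))
        = z ^ t := by
      rw [hz, ← Complex.exp_nat_mul]
      congr 1
      push_cast
      ring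
    have hz1 : z ≠ 1 := by
      intro hz1
      obtain ⟨m, hm⟩ := Complex.exp_eq_one_iff.1 hz1
      have hc : (2 * Real.pi * Complex.I : ℂ) ≠ 0 := Complex.two_pi_I_ne_zero
      have hnm : (n : ℂ) = m * (k + 1) := by
        field_simp at hm
        apply mul_left_cancel₀ hc
        linear_combination (2 * Real.pi * Complex.I : ℂ) * hm
      have hdvd : ((k : ℤ) + 1) ∣ n := ⟨m, by rw [mul_comm]; exact_mod_cast hnm⟩
      have := Int.le_of_dvd (abs_pos.2 h) ((dvd_abs _ _).2 hdvd)
      omega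
    have hzk : z ^ (k + 1) = 1 := by
      rw [hz, ← Complex.exp_nat_mul, Complex.exp_eq_one_iff]
      refine ⟨n, ?_⟩
      push_cast
      field_simp
    simp_rw [hpow]
    rw [Fin.sum_univ_eq_sum_range (fun t => z ^ t), geom_sum_eq hz1, hzk]
    simp

/-- The difference of the multiplicities of `j` in the words `x` and `y`. -/
def multiplicityDiff {d k' : ℕ} (x y : Fin k' → Fin d) (j : Fin d) : ℤ :=
  (Finset.univ.filter fun m => x m = j).card - (Finset.univ.filter fun m => y m = j).card

theorem abs_multiplicityDiff_le {d k' : ℕ} (x y : Fin k' → Fin d) (j : Fin d) :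
    |multiplicityDiff x y j| ≤ k' := by
  have hx := Finset.card_le_univ (Finset.univ.filter fun m => x m = j)
  have hy := Finset.card_le_univ (Finset.univ.filter fun m => y m = j)
  rw [Fintype.card_fin] at hx hy
  rw [multiplicityDiff, abs_le]
  omega

theorem sum_word_eq_sum_card_mul {d k' : ℕ} (x : Fin k' → Fin d) (θ : Fin d → ℂ) :
    ∑ m, θ (x m) = ∑ j, ((Finset.univ.filter fun m => x m = j).card : ℂ) * θ j := by
  rw [← Finset.sum_fiberwise Finset.univ x]
  refine Finset.sum_congr rfl fun j _ => ?_
  rw [← nsmul_eq_mul, ← Finset.sum_const]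
  exact Finset.sum_congr rfl fun m hm => by rw [(Finset.mem_filter.1 hm).2]

/-- Conjugation by `LamPow` multiplies each matrix entry by a product of characters. -/
theorem LamPow_conj_apply {d k' : ℕ} (M : Matrix (Fin k' → Fin d) (Fin k' → Fin d) ℂ)
    (θ : Fin d → ℝ) (x y : Fin k' → Fin d) :
    (LamPow k' θ * M * (LamPow k' θ)ᴴ) x y
      = M x y * ∏ j, Complex.exp (Complex.I * multiplicityDiff x y j * θ j) := by
  have hexp : ∑ j, Complex.I * multiplicityDiff x y j * θ j
      = Complex.I * ∑ m, (θ (x m) : ℂ) + -(Complex.I * ∑ m, (θ (y m) : ℂ)) := by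
    rw [sum_word_eq_sum_card_mul x (fun j => (θ j : ℂ)),
      sum_word_eq_sum_card_mul y (fun j => (θ j : ℂ)), ← sub_eq_add_neg, ← mul_sub,
      ← Finset.sum_sub_distrib, Finset.mul_sum]
    refine Finset.sum_congr rfl fun j _ => ?_
    rw [multiplicityDiff]
    push_cast
    ring
  rw [LamPow, diagonal_conjTranspose, mul_diagonal, diagonal_mul, ← Complex.exp_sum, hexp,
    Complex.exp_add]
  simp only [Pi.star_apply, Complex.star_def, ← Complex.exp_conj, map_mul, Complex.conj_I,
    map_sum, Complex.conj_ofReal, Complex.ofReal_sum, neg_mul]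
  ring

theorem integrable_LamPow_conj {d k' : ℕ} (M : Matrix (Fin k' → Fin d) (Fin k' → Fin d) ℂ)
    (x y : Fin k' → Fin d) :
    Integrable (fun θ => (LamPow k' θ * M * (LamPow k' θ)ᴴ) x y) (phaseMeasure (Fin d)) := by
  simp_rw [LamPow_conj_apply]
  have : IsProbabilityMeasure (phaseMeasure (Fin d)) := by
    unfold phaseMeasure
    infer_instance
  refine Integrable.of_bound (C := ‖M x y‖)
    (Continuous.aestronglyMeasurable (by fun_prop)) (Filter.Eventually.of_forall fun θ => ?_)
  have h (j : Fin d) : ‖Complex.exp (Complex.I * multiplicityDiff x y j * θ j)‖ = 1 := by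
    simp [Complex.norm_exp]
  simp [norm_prod, h]

theorem integral_LamPow_conj_apply {d k' : ℕ}
    (M : Matrix (Fin k' → Fin d) (Fin k' → Fin d) ℂ) (x y : Fin k' → Fin d) :
    (∫ θ : Fin d → ℝ, LamPow k' θ * M * (LamPow k' θ)ᴴ ∂(phaseMeasure (Fin d))) x y
      = ∫ θ : Fin d → ℝ, (LamPow k' θ * M * (LamPow k' θ)ᴴ) x y ∂(phaseMeasure (Fin d)) := by
  have hrow (x : Fin k' → Fin d) : Integrable
      (fun θ => (LamPow k' θ * M * (LamPow k' θ)ᴴ) x) (phaseMeasure (Fin d)) :=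
    Integrable.of_eval fun y => integrable_LamPow_conj M x y
  exact (congrFun (eval_integral hrow x) y).trans
    (eval_integral (fun y => integrable_LamPow_conj M x y) y)

theorem stmt6 (k d k' : ℕ) (hk : 1 ≤ k) (hd : 1 ≤ d) (hk'1 : 1 ≤ k') (hk'k : k' ≤ k)
    (M : Matrix (Fin k' → Fin d) (Fin k' → Fin d) ℂ) :
    (((k : ℂ) + 1) ^ d)⁻¹ •
      (∑ φ : Fin d → Fin (k + 1),
        LamPow k' (fun j => 2 * Real.pi * (φ j : ℝ) / (k + 1)) * M *
          (LamPow k' (fun j => 2 * Real.pi * (φ j : ℝ) / (k + 1)))ᴴ)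
    = ∫ θ : Fin d → ℝ, LamPow k' θ * M * (LamPow k' θ)ᴴ ∂(phaseMeasure (Fin d)) := by
  ext x y
  rw [integral_LamPow_conj_apply, Matrix.smul_apply, Matrix.sum_apply]
  simp_rw [LamPow_conj_apply]
  rw [integral_const_mul, phaseMeasure,
    integral_fintype_prod_eq_prod (𝕜 := ℂ)
      (fun j (t : ℝ) => Complex.exp (Complex.I * multiplicityDiff x y j * t)),
    ← Finset.mul_sum, smul_eq_mul, mul_left_comm]
  congr 1
  have hcard : (((k : ℂ) + 1) ^ d)⁻¹ = ∏ _j : Fin d, ((k : ℂ) + 1)⁻¹ := by simp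
  rw [hcard, ← Fintype.prod_sum (fun (j : Fin d) (t : Fin (k + 1)) =>
    Complex.exp (Complex.I * multiplicityDiff x y j *
      ((2 * Real.pi * (t : ℝ) / (k + 1) : ℝ) : ℂ))), ← Finset.prod_mul_distrib]
  refine Finset.prod_congr rfl fun j _ => ?_
  rw [integral_exp_uniformPhase, average_exp_discrete_phases]
  exact (abs_multiplicityDiff_le x y j).trans (by exact_mod_cast hk'k)
end

section
/- (Final variance bound for the global classical shadow.) Let d ≥ 1, let O be a d×d Hermitian complex matrix, and let ρ be a density matrix. Then ((d+1)/(d+2))·(Tr(O²) + 2·Tr(O²ρ)) − (1/(d+2))·(2·Tr(O)·Tr(Oρ) + Tr(O)²) − Tr(Oρ)² ≤ 3·Tr(O²), where all traces appearing are real numbers (i.e. the inequality holds for their real parts). -/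
open MeasureTheory Matrix Complex
open scoped ComplexOrder

open scoped MatrixOrder in
theorem Matrix.PosSemidef.exists_eq_conjTranspose_mul_self {n : Type*} [Fintype n] [DecidableEq n]
    {A : Matrix n n ℂ} (hA : A.PosSemidef) : ∃ B : Matrix n n ℂ, A = Bᴴ * B :=
  CStarAlgebra.nonneg_iff_eq_star_mul_self.mp hA.nonneg

section Frobenius

attribute [local instance] Matrix.frobeniusNormedRing

theorem re_trace_conjTranspose_mul_self {n : Type*} [Fintype n] [DecidableEq n]
    (A : Matrix n n ℂ) : ((Aᴴ * A).trace).re = ‖A‖ ^ 2 := by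
  have h0 : 0 ≤ ∑ i, ∑ j, ‖A i j‖ ^ (2 : ℝ) := by positivity
  rw [Matrix.frobenius_norm_def, ← Real.rpow_natCast, ← Real.rpow_mul h0, Finset.sum_comm]
  simp [Matrix.trace, Matrix.mul_apply, ← Complex.normSq_eq_norm_sq, Complex.normSq_apply]

theorem re_trace_mul_self_mul_le {n : Type*} [Fintype n] [DecidableEq n]
    {O ρ : Matrix n n ℂ} (hO : O.IsHermitian) (hρ : ρ.PosSemidef) :
    ((O * O * ρ).trace).re ≤ ((O * O).trace).re * (ρ.trace).re := by
  obtain ⟨B, rfl⟩ := hρ.exists_eq_conjTranspose_mul_self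
  have h1 : (O * O * (Bᴴ * B)).trace = ((O * Bᴴ)ᴴ * (O * Bᴴ)).trace := by
    rw [Matrix.conjTranspose_mul, Matrix.conjTranspose_conjTranspose, hO.eq,
      ← Matrix.mul_assoc, Matrix.trace_mul_comm]
    simp only [Matrix.mul_assoc]
  have h2 : (O * O).trace = (Oᴴ * O).trace := by rw [hO.eq]
  rw [h1, h2]
  simp only [re_trace_conjTranspose_mul_self]
  rw [← mul_pow, ← Matrix.frobenius_norm_conjTranspose B]
  gcongr
  exact Matrix.frobenius_norm_mul O Bᴴ

theorem re_trace_mul_self_nonneg {n : Type*} [Fintype n] [DecidableEq n]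
    {O : Matrix n n ℂ} (hO : O.IsHermitian) : 0 ≤ ((O * O).trace).re := by
  have h : (O * O).trace = (Oᴴ * O).trace := by rw [hO.eq]
  rw [h, re_trace_conjTranspose_mul_self]
  positivity

end Frobenius

theorem stmt11 (d : ℕ) (hd : 1 ≤ d)
    (O : Matrix (Fin d) (Fin d) ℂ) (hO : O.IsHermitian)
    (ρ : Matrix (Fin d) (Fin d) ℂ) (hρ : ρ.PosSemidef) (hρ1 : ρ.trace = 1) :
    ((d : ℝ) + 1) / ((d : ℝ) + 2) * (((O * O).trace).re + 2 * ((O * O * ρ).trace).re)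
      - 1 / ((d : ℝ) + 2) *
          (2 * (O.trace).re * ((O * ρ).trace).re + ((O.trace).re) ^ 2)
      - (((O * ρ).trace).re) ^ 2
    ≤ 3 * ((O * O).trace).re := by
  have hq := re_trace_mul_self_mul_le hO hρ
  rw [hρ1, Complex.one_re, mul_one] at hq
  have hS := re_trace_mul_self_nonneg hO
  generalize ((O * O * ρ).trace).re = q at *
  generalize ((O * O).trace).re = S at *
  generalize ((O * ρ).trace).re = a
  generalize (O.trace).re = t
  have hd' : (0 : ℝ) ≤ d := d.cast_nonneg
  have hpos : (0 : ℝ) < d + 2 := by positivity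
  have key : ((d : ℝ) + 1) / (d + 2) * (S + 2 * q) - 1 / (d + 2) * (2 * t * a + t ^ 2) - a ^ 2
      = (((d : ℝ) + 1) * (S + 2 * q) - (t + a) ^ 2 - (d + 1) * a ^ 2) / (d + 2) := by
    field_simp
    ring
  rw [key, div_le_iff₀ hpos]
  have hmul : ((d : ℝ) + 1) * q ≤ (d + 1) * S := by gcongr
  have hsq : 0 ≤ ((d : ℝ) + 1) * a ^ 2 := by positivity
  linarith [sq_nonneg (t + a)]
end

section
/- (Variance bound for the Hadamard-based diagonal shadow.) Let d ≥ 1, let O be a d×d Hermitian complex matrix with all diagonal entries equal to zero, and let ρ be a density matrix. Then Re[ Σ_{i,j,k} ( O_{ij} O_{ji} ρ_{kk} + O_{ij} O_{jk} ρ_{ki} + O_{ik} O_{ji} ρ_{kj} ) − Σ_{i,j} ( O_{ij} O_{ji} ρ_{jj} + O_{ij} O_{ji} ρ_{ii} ) − (Tr(Oρ))² ] ≤ Tr(O²) + 2·Tr(O²ρ) ≤ 3·Tr(O²), where Tr(O²) and Tr(O²ρ) are real numbers. -/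
open MeasureTheory Matrix Complex
open scoped ComplexOrder

theorem Matrix.IsHermitian.mul_apply_swap_nonneg {n : Type*} {A : Matrix n n ℂ}
    (hA : A.IsHermitian) (i j : n) : 0 ≤ A i j * A j i := by
  rw [← hA.apply j i]
  exact mul_star_self_nonneg _

section TraceInequalities

variable {n : Type*} [Fintype n]

theorem trace_conjTranspose_mul_self_eq_sum_norm_sq (A : Matrix n n ℂ) :
    (Aᴴ * A).trace = ((∑ i, ∑ j, ‖A i j‖ ^ 2 : ℝ) : ℂ) := by
  simp only [trace, diag_apply, mul_apply, conjTranspose_apply]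
  rw [Finset.sum_comm]
  push_cast
  simp [Complex.conj_mul']

attribute [local instance] Matrix.frobeniusNormedAddCommGroup in
theorem trace_conjTranspose_mul_self_re_eq_frobenius_norm_sq (A : Matrix n n ℂ) :
    ((Aᴴ * A).trace).re = ‖A‖ ^ 2 := by
  rw [trace_conjTranspose_mul_self_eq_sum_norm_sq, ofReal_re, frobenius_norm_def,
    ← Real.sqrt_eq_rpow, Real.sq_sqrt (by positivity)]
  simp

attribute [local instance] Matrix.frobeniusNormedAddCommGroup in
theorem trace_conjTranspose_mul_self_mul_re_le (A B : Matrix n n ℂ) :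
    (((A * B)ᴴ * (A * B)).trace).re ≤ ((Aᴴ * A).trace).re * ((Bᴴ * B).trace).re := by
  simp only [trace_conjTranspose_mul_self_re_eq_frobenius_norm_sq, ← mul_pow]
  gcongr
  exact frobenius_norm_mul A B

open scoped MatrixOrder in
theorem Matrix.PosSemidef.trace_sq_mul_re_le {ρ O : Matrix n n ℂ} (hρ : ρ.PosSemidef)
    (hO : O.IsHermitian) :
    ((O * O * ρ).trace).re ≤ (ρ.trace).re * ((O * O).trace).re := by
  classical
  obtain ⟨B, rfl⟩ := CStarAlgebra.nonneg_iff_eq_star_mul_self.mp hρ.nonneg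
  rw [star_eq_conjTranspose]
  have h := trace_conjTranspose_mul_self_mul_re_le B O
  rw [conjTranspose_mul, hO.eq] at h
  rw [Matrix.mul_assoc O O, Matrix.trace_mul_comm]
  simpa only [Matrix.mul_assoc] using h

theorem Matrix.IsHermitian.trace_mul_im_eq_zero {A B : Matrix n n ℂ} (hA : A.IsHermitian)
    (hB : B.IsHermitian) : ((A * B).trace).im = 0 := by
  rw [← Complex.conj_eq_iff_im, starRingEnd_apply, ← trace_conjTranspose, conjTranspose_mul,
    hA.eq, hB.eq, trace_mul_comm]

end TraceInequalities

theorem stmt13 (d : ℕ) (hd : 1 ≤ d)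
    (O : Matrix (Fin d) (Fin d) ℂ) (hO : O.IsHermitian) (hdiag : ∀ i, O i i = 0)
    (ρ : Matrix (Fin d) (Fin d) ℂ) (hρ : ρ.PosSemidef) (hρ1 : ρ.trace = 1) :
    ((∑ i : Fin d, ∑ j : Fin d, ∑ k : Fin d,
          (O i j * O j i * ρ k k + O i j * O j k * ρ k i + O i k * O j i * ρ k j))
        - (∑ i : Fin d, ∑ j : Fin d, (O i j * O j i * ρ j j + O i j * O j i * ρ i i))
        - ((O * ρ).trace) ^ 2).re
      ≤ ((O * O).trace).re + 2 * ((O * O * ρ).trace).re ∧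
    ((O * O).trace).re + 2 * ((O * O * ρ).trace).re ≤ 3 * ((O * O).trace).re := by
  constructor
  · have hpurity : ∑ i, ∑ j, ∑ k, O i j * O j i * ρ k k = (O * O).trace := by
      simp only [← Finset.mul_sum]
      simp only [show ∑ k, ρ k k = 1 from hρ1, mul_one]
      simp [trace, mul_apply]
    have hcycle : ∑ i, ∑ j, ∑ k, O i j * O j k * ρ k i = (O * O * ρ).trace := by
      simp only [trace, diag_apply, mul_apply, Finset.sum_mul]
      exact Finset.sum_congr rfl fun i _ => Finset.sum_comm
    have hcycle' : ∑ i, ∑ j, ∑ k, O i k * O j i * ρ k j = (O * O * ρ).trace := by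
      rw [← hcycle, Finset.sum_comm]
      simp only [mul_comm (O _ _) (O _ _)]
    have hdiagonal : 0 ≤ ∑ i, ∑ j, (O i j * O j i * ρ j j + O i j * O j i * ρ i i) :=
      Finset.sum_nonneg fun i _ => Finset.sum_nonneg fun j _ =>
        add_nonneg (mul_nonneg (hO.mul_apply_swap_nonneg i j) hρ.diag_nonneg)
          (mul_nonneg (hO.mul_apply_swap_nonneg i j) hρ.diag_nonneg)
    have hre := (Complex.le_def.mp hdiagonal).1
    have him := hO.trace_mul_im_eq_zero hρ.isHermitian
    simp only [Finset.sum_add_distrib, hpurity, hcycle, hcycle'] at hre ⊢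
    simp only [sub_re, add_re, zero_re, sq, mul_re, him] at hre ⊢
    nlinarith [mul_self_nonneg ((O * ρ).trace).re]
  · have h := hρ.trace_sq_mul_re_le hO
    rw [hρ1, one_re, one_mul] at h
    linarith
end
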